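/- arXiv:2506.15007 — 5 statements merged into one kernel-verified Lean document; each statement's English description precedes it below -/
import Mathlib

section
/- Let D ⊆ ℝ be a convex set and m : ℝ → ℝ a function that is concave on D and satisfies m ≥ 0 on D. Then the action density Ψ is jointly convex on ℝ × ℝ^d with values in [0,+∞]: for all θ ∈ [0,1] and all (u₁,v₁), (u₂,v₂) ∈ ℝ × ℝ^d one has Ψ(θu₁+(1−θ)u₂, θv₁+(1−θ)v₂) ≤ θ·Ψ(u₁,v₁) + (1−θ)·Ψ(u₂,v₂), where the right-hand side is computed in the extended nonnegative reals. -/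
open MeasureTheory Filter Topology
open scoped ENNReal Classical

/-- The action density `Ψ` associated with a mobility `m` with domain `D`:
`Ψ(u,v) = ‖v‖²/m(u)` if `u ∈ D` and `m(u) > 0`, `Ψ(u,v) = 0` if `u ∈ D`, `m(u) = 0` and
`v = 0`, and `Ψ(u,v) = +∞` otherwise. -/
noncomputable def Psi {d : ℕ} (D : Set ℝ) (m : ℝ → ℝ)
    (u : ℝ) (v : EuclideanSpace ℝ (Fin d)) : ℝ≥0∞ :=
  if u ∈ D ∧ 0 < m u then ENNReal.ofReal (‖v‖ ^ 2 / m u)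
  else if u ∈ D ∧ m u = 0 ∧ v = 0 then 0
  else ⊤

theorem Psi_le_ofReal_iff {d : ℕ} {D : Set ℝ} {m : ℝ → ℝ} (hm0 : ∀ u ∈ D, 0 ≤ m u)
    {u : ℝ} {v : EuclideanSpace ℝ (Fin d)} {c : ℝ} (hc : 0 ≤ c) :
    Psi D m u v ≤ ENNReal.ofReal c ↔ u ∈ D ∧ ‖v‖ ^ 2 ≤ c * m u := by
  unfold Psi
  split_ifs with h₁ h₂
  · rw [ENNReal.ofReal_le_ofReal_iff hc, div_le_iff₀ h₁.2]
    exact ⟨fun h => ⟨h₁.1, h⟩, fun h => h.2⟩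
  · simp [h₂.1, h₂.2.1, h₂.2.2]
  · simp only [top_le_iff, ENNReal.ofReal_ne_top, false_iff, not_and, not_le]
    intro hu
    have hmu : m u = 0 := le_antisymm (not_lt.1 fun h => h₁ ⟨hu, h⟩) (hm0 u hu)
    have hv : v ≠ 0 := fun h => h₂ ⟨hu, hmu, h⟩
    have := norm_pos_iff.2 hv
    rw [hmu, mul_zero]
    positivity

theorem norm_smul_add_smul_sq_le {E : Type*} [SeminormedAddCommGroup E] [NormedSpace ℝ E]
    {v w : E} {s t a b p q : ℝ} (hs : 0 ≤ s) (ht : 0 ≤ t) (ha : 0 ≤ a) (hb : 0 ≤ b)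
    (hp : 0 ≤ p) (hq : 0 ≤ q) (hv : ‖v‖ ^ 2 ≤ a * p) (hw : ‖w‖ ^ 2 ≤ b * q) :
    ‖s • v + t • w‖ ^ 2 ≤ (s * a + t * b) * (s * p + t * q) := by
  have htri : ‖s • v + t • w‖ ≤ s * ‖v‖ + t * ‖w‖ := by
    simpa [norm_smul, abs_of_nonneg hs, abs_of_nonneg ht] using norm_add_le (s • v) (t • w)
  have hcross : 2 * (‖v‖ * ‖w‖) ≤ a * q + b * p := by
    refine abs_le_of_sq_le_sq' ?_ (by positivity) |>.2
    have h := mul_le_mul hv hw (by positivity) (by positivity)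
    nlinarith [sq_nonneg (a * q - b * p)]
  calc ‖s • v + t • w‖ ^ 2 ≤ (s * ‖v‖ + t * ‖w‖) ^ 2 := by gcongr
    _ = s ^ 2 * ‖v‖ ^ 2 + s * t * (2 * (‖v‖ * ‖w‖)) + t ^ 2 * ‖w‖ ^ 2 := by ring
    _ ≤ s ^ 2 * (a * p) + s * t * (a * q + b * p) + t ^ 2 * (b * q) := by gcongr
    _ = (s * a + t * b) * (s * p + t * q) := by ring

/-- the action density `Ψ` is jointly convex on `ℝ × ℝ^d` with values in
`[0,+∞]`, provided the domain `D` is convex and the mobility `m` is concave and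
nonnegative on `D`. -/
theorem psi_jointly_convex {d : ℕ} (D : Set ℝ) (hD : Convex ℝ D) (m : ℝ → ℝ)
    (hconc : ConcaveOn ℝ D m) (hm0 : ∀ u ∈ D, 0 ≤ m u) :
    ∀ θ : ℝ, θ ∈ Set.Icc (0 : ℝ) 1 →
      ∀ (u₁ u₂ : ℝ) (v₁ v₂ : EuclideanSpace ℝ (Fin d)),
        Psi D m (θ * u₁ + (1 - θ) * u₂) (θ • v₁ + (1 - θ) • v₂) ≤
          ENNReal.ofReal θ * Psi D m u₁ v₁ + ENNReal.ofReal (1 - θ) * Psi D m u₂ v₂ := by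
  rintro θ ⟨hθ0, hθ1⟩ u₁ u₂ v₁ v₂
  rcases hθ0.eq_or_lt with rfl | hθ0
  · simp
  rcases hθ1.eq_or_lt with rfl | hθ1
  · simp
  have hθ1' : 0 < 1 - θ := sub_pos.2 hθ1
  by_cases h₁ : Psi D m u₁ v₁ = ⊤
  · simp [h₁, ENNReal.mul_top, hθ0]
  by_cases h₂ : Psi D m u₂ v₂ = ⊤
  · simp [h₂, ENNReal.mul_top, hθ1]
  obtain ⟨a, ha, hPa⟩ : ∃ a : ℝ, 0 ≤ a ∧ Psi D m u₁ v₁ = ENNReal.ofReal a :=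
    ⟨_, ENNReal.toReal_nonneg, (ENNReal.ofReal_toReal h₁).symm⟩
  obtain ⟨b, hb, hPb⟩ : ∃ b : ℝ, 0 ≤ b ∧ Psi D m u₂ v₂ = ENNReal.ofReal b :=
    ⟨_, ENNReal.toReal_nonneg, (ENNReal.ofReal_toReal h₂).symm⟩
  obtain ⟨hu₁, hv₁⟩ := (Psi_le_ofReal_iff hm0 ha).1 hPa.le
  obtain ⟨hu₂, hv₂⟩ := (Psi_le_ofReal_iff hm0 hb).1 hPb.le
  rw [hPa, hPb, ← ENNReal.ofReal_mul hθ0.le, ← ENNReal.ofReal_mul hθ1'.le,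
    ← ENNReal.ofReal_add (by positivity) (by positivity), Psi_le_ofReal_iff hm0 (by positivity)]
  refine ⟨hD hu₁ hu₂ hθ0.le hθ1'.le (by ring), ?_⟩
  refine (norm_smul_add_smul_sq_le hθ0.le hθ1'.le ha hb (hm0 _ hu₁) (hm0 _ hu₂) hv₁ hv₂).trans ?_
  exact mul_le_mul_of_nonneg_left (hconc.2 hu₁ hu₂ hθ0.le hθ1'.le (by ring)) (by positivity)
end

section
/- Let D ⊆ ℝ be a closed set and m : ℝ → ℝ a function with m ≥ 0 on D which is upper semicontinuous relative to D (equivalently, for every c ∈ ℝ the superlevel set {u ∈ D : m(u) ≥ c} is closed in ℝ). Then the action density Ψ is lower semicontinuous as a function ℝ × ℝ^d → [0,+∞]: for every (u,v) and every sequence (uₙ,vₙ) → (u,v), one has Ψ(u,v) ≤ liminf_{n→∞} Ψ(uₙ,vₙ). -/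
open MeasureTheory Filter Topology
open scoped ENNReal Classical

/-- The sublevel sets of `Psi` at finite levels, in division-free form. -/
theorem Psi_le_coe_iff {d : ℕ} {D : Set ℝ} {m : ℝ → ℝ} (hm0 : ∀ u ∈ D, 0 ≤ m u)
    (u : ℝ) (v : EuclideanSpace ℝ (Fin d)) (t : NNReal) :
    Psi D m u v ≤ t ↔ u ∈ D ∧ ‖v‖ ^ 2 ≤ t * m u := by
  unfold Psi
  by_cases hu : u ∈ D
  · rcases (hm0 u hu).eq_or_lt with h | h
    · by_cases hv : v = 0 <;> simp [hu, ← h, hv]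
    · rw [if_pos ⟨hu, h⟩, ENNReal.ofReal_le_coe, div_le_iff₀ h]
      simp [hu]
  · simp [hu]

/-- if `D` is closed, `m ≥ 0` on `D` and `m` is upper semicontinuous
relative to `D` (all superlevel sets `{u ∈ D | m u ≥ c}` are closed), then the action
density `Ψ` is (sequentially) lower semicontinuous on `ℝ × ℝ^d`. -/
theorem psi_lower_semicontinuous {d : ℕ} (D : Set ℝ) (hD : IsClosed D) (m : ℝ → ℝ)
    (hm0 : ∀ u ∈ D, 0 ≤ m u)
    (husc : ∀ c : ℝ, IsClosed {u : ℝ | u ∈ D ∧ c ≤ m u}) :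
    ∀ (u : ℝ) (v : EuclideanSpace ℝ (Fin d))
      (un : ℕ → ℝ) (vn : ℕ → EuclideanSpace ℝ (Fin d)),
      Tendsto un atTop (𝓝 u) → Tendsto vn atTop (𝓝 v) →
      Psi D m u v ≤ atTop.liminf (fun n => Psi D m (un n) (vn n)) := by
  intro u v un vn hun hvn
  refine le_of_forall_lt fun b hb => ?_
  obtain ⟨b', hbb', hb'⟩ := exists_between hb
  refine hbb'.trans_le ?_
  lift b' to NNReal using hb'.ne_top
  refine le_liminf_of_le (by isBoundedDefault) ?_
  rw [← not_le, Psi_le_coe_iff hm0] at hb'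
  suffices h : ∀ᶠ n in atTop, ¬ Psi D m (un n) (vn n) ≤ b' from
    h.mono fun n hn => (not_le.mp hn).le
  simp only [Psi_le_coe_iff hm0]
  by_cases hu : u ∈ D
  · have hlt : (b' : ℝ) * m u < ‖v‖ ^ 2 := not_le.mp fun h => hb' ⟨hu, h⟩
    obtain ⟨c, hbc, hc⟩ : ∃ c, (b' : ℝ) * c < ‖v‖ ^ 2 ∧ m u < c := by
      have hcont : Tendsto (fun c : ℝ => (b' : ℝ) * c) (𝓝[>] m u) (𝓝 (b' * m u)) :=
        (Continuous.tendsto (by fun_prop) (m u)).mono_left nhdsWithin_le_nhds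
      exact ((hcont.eventually_lt_const hlt).and self_mem_nhdsWithin).exists
    filter_upwards [hun.eventually ((husc c).isOpen_compl.mem_nhds fun h => hc.not_ge h.2),
      (hvn.norm.pow 2).eventually_const_lt hbc] with n hn hvn' ⟨hD', hle⟩
    have hmc : m (un n) ≤ c := (not_le.mp fun h => hn ⟨hD', h⟩).le
    exact (hvn'.trans_le hle).not_ge (mul_le_mul_of_nonneg_left hmc b'.2)
  · filter_upwards [hun.eventually (hD.isOpen_compl.mem_nhds hu)] with n hn h
    exact hn h.1
end

section
/- Let X be a compact metric space with Borel σ-algebra and λ a finite Borel measure on X. Let D ⊆ ℝ be a closed convex set and m : ℝ → ℝ concave on D, with m ≥ 0 on D and upper semicontinuous relative to D (for every c ∈ ℝ the set {u ∈ D : m(u) ≥ c} is closed in ℝ). Let uₙ, u ∈ L¹(X,λ;ℝ) and wₙ, w ∈ L¹(X,λ;ℝ^d) be such that ∫ φ uₙ dλ → ∫ φ u dλ for every continuous φ : X → ℝ and ∫ ⟨Φ, wₙ⟩ dλ → ∫ ⟨Φ, w⟩ dλ for every continuous Φ : X → ℝ^d. Then ∫_X Ψ(u(x), w(x)) dλ(x)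 ≤ liminf_{n→∞} ∫_X Ψ(uₙ(x), wₙ(x)) dλ(x), where the integrals are Lebesgue integrals with values in [0,+∞]. -/
open MeasureTheory Filter Topology
open scoped ENNReal Classical RealInnerProductSpace

section Approximation

variable {X : Type*} [MetricSpace X] [CompactSpace X] [MeasurableSpace X] [BorelSpace X]
  {lam : Measure X} [IsFiniteMeasure lam]

/-- An integrable function on a compact metric space is the almost everywhere limit of a sequence
of continuous functions. -/
lemma exists_seq_continuousMap_tendsto_ae {f : X → ℝ} (hf : Integrable f lam) :
    ∃ g : ℕ → C(X, ℝ), ∀ᵐ x ∂lam, Tendsto (fun k => g k x) atTop (𝓝 (f x)) := by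
  have hmem : MemLp f 1 lam := memLp_one_iff_integrable.2 hf
  have key (k : ℕ) := hmem.exists_boundedContinuous_eLpNorm_sub_le ENNReal.one_ne_top
    (ε := ((k : ℝ≥0∞) + 1)⁻¹) (by simp)
  choose g hg hgm using key
  have hlim : Tendsto (fun k => eLpNorm ((g k : X → ℝ) - f) 1 lam) atTop (𝓝 0) := by
    refine tendsto_of_tendsto_of_tendsto_of_le_of_le tendsto_const_nhds
      ((tendsto_add_atTop_iff_nat 1).2 ENNReal.tendsto_inv_nat_nhds_zero) (fun _ => zero_le) ?_
    intro k
    simpa [eLpNorm_sub_comm (g k : X → ℝ) f] using hg k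
  obtain ⟨ns, -, hns⟩ := (tendstoInMeasure_of_tendsto_eLpNorm one_ne_zero
    (fun k => (hgm k).aestronglyMeasurable) hmem.aestronglyMeasurable hlim).exists_seq_tendsto_ae
  exact ⟨fun k => (g (ns k)).toContinuousMap, hns⟩

/-- A subpartition of unity by integrable functions is the almost everywhere limit of a sequence of
continuous subpartitions of unity. -/
lemma exists_seq_continuousMap_subpartition_tendsto_ae (s : Finset ℕ) {t : ℕ → X → ℝ}
    (ht : ∀ i, Integrable (t i) lam) (ht0 : ∀ i x, 0 ≤ t i x) (ht1 : ∀ x, ∑ i ∈ s, t i x ≤ 1) :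
    ∃ φ : ℕ → ℕ → C(X, ℝ), (∀ k i x, 0 ≤ φ k i x) ∧ (∀ k x, ∑ i ∈ s, φ k i x ≤ 1) ∧
      ∀ᵐ x ∂lam, ∀ i ∈ s, Tendsto (fun k => φ k i x) atTop (𝓝 (t i x)) := by
  choose g hg using fun i => exists_seq_continuousMap_tendsto_ae (ht i)
  have hpos (k : ℕ) (x : X) : 0 < max 1 (∑ i ∈ s, max 0 (g i k x)) :=
    zero_lt_one.trans_le (le_max_left _ _)
  refine ⟨fun k i => ⟨fun x => max 0 (g i k x) / max 1 (∑ j ∈ s, max 0 (g j k x)), ?_⟩, ?_, ?_, ?_⟩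
  · exact Continuous.div (by fun_prop) (by fun_prop) fun x => (hpos k x).ne'
  · intro k i x
    exact div_nonneg (le_max_left _ _) (hpos k x).le
  · intro k x
    simp only [ContinuousMap.coe_mk]
    rw [← Finset.sum_div]
    exact (div_le_one (hpos k x)).2 (le_max_right _ _)
  · filter_upwards [ae_all_iff.2 hg] with x hx i _
    have hmax (j : ℕ) : Tendsto (fun k => max 0 (g j k x)) atTop (𝓝 (t j x)) := by
      simpa [max_eq_right (ht0 j x)] using (tendsto_const_nhds (x := (0 : ℝ))).max (hx j)
    have hden : Tendsto (fun k => max 1 (∑ j ∈ s, max 0 (g j k x))) atTop (𝓝 1) := by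
      simpa [max_eq_left (ht1 x)] using
        (tendsto_const_nhds (x := (1 : ℝ))).max (tendsto_finsetSum s fun j _ => hmax j)
    have hdiv := (hmax i).div hden one_ne_zero
    rwa [div_one] at hdiv

/-- A finite supremum of measurable functions is attained along a measurable subpartition. -/
lemma exists_measurable_subpartition_le_sum {X : Type*} [MeasurableSpace X] {f : ℕ → X → ℝ}
    (hf : ∀ i, Measurable (f i)) (N : ℕ) :
    ∃ A : ℕ → Set X, (∀ i, MeasurableSet (A i)) ∧ Pairwise (Function.onFun Disjoint A) ∧
      ∀ x, (∀ i, 0 ≤ (A i).indicator (f i) x) ∧ ∀ i < N,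
        f i x ≤ ∑ j ∈ Finset.range N, (A j).indicator (f j) x := by
  let B (i : ℕ) : Set X := {x | 0 ≤ f i x} ∩ ⋂ j ∈ Finset.range N, {x | f j x ≤ f i x}
  have hB (i : ℕ) : MeasurableSet (B i) :=
    (measurableSet_le measurable_const (hf i)).inter
      (Finset.measurableSet_biInter _ fun j _ => measurableSet_le (hf j) (hf i))
  have h0 (x : X) (i : ℕ) : 0 ≤ (disjointed B i).indicator (f i) x := by
    by_cases hx : x ∈ disjointed B i
    · rw [Set.indicator_of_mem hx]
      exact (disjointed_subset B i hx).1
    · rw [Set.indicator_of_notMem hx]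
  refine ⟨disjointed B, MeasurableSet.disjointed hB, disjoint_disjointed B,
    fun x => ⟨h0 x, fun i hi => ?_⟩⟩
  obtain hneg | hnonneg := lt_or_ge (f i x) 0
  · exact hneg.le.trans (Finset.sum_nonneg fun j _ => h0 x j)
  obtain ⟨j, hj, hmax⟩ := Finset.exists_max_image (Finset.range N) (fun j => f j x)
    ⟨i, Finset.mem_range.2 hi⟩
  have hxB : x ∈ B j := by
    refine ⟨hnonneg.trans (hmax i (Finset.mem_range.2 hi)), ?_⟩
    simpa using hmax
  have hex : ∃ n, x ∈ B n := ⟨j, hxB⟩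
  have hle : Nat.find hex ≤ j := Nat.find_min' hex hxB
  have hlt : Nat.find hex < N := hle.trans_lt (Finset.mem_range.1 hj)
  have hmem : x ∈ disjointed B (Nat.find hex) := by
    rw [disjointed_eq_inter_compl]
    refine ⟨Nat.find_spec hex, ?_⟩
    simp only [Set.mem_iInter]
    exact fun l hl => Nat.find_min hex hl
  have hfi : f i x ≤ f (Nat.find hex) x := by
    have := (Nat.find_spec hex).2
    simp only [Set.mem_iInter] at this
    exact this i (Finset.mem_range.2 hi)
  rw [← Set.indicator_of_mem hmem (f (Nat.find hex))] at hfi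
  exact hfi.trans (Finset.single_le_sum (f := fun j => (disjointed B j).indicator (f j) x)
    (fun l _ => h0 x l) (Finset.mem_range.2 hlt))

/-- Localization: a bound on all integrals `∑ i, ∫ φ i * f i` over continuous subpartitions of unity
bounds the integral of the supremum of the positive parts. -/
lemma lintegral_iSup_ofReal_le_of_subpartition {f : ℕ → X → ℝ} (hf : ∀ i, Measurable (f i))
    (hfi : ∀ i, Integrable (f i) lam) {L : ℝ≥0∞}
    (hL : ∀ (s : Finset ℕ) (φ : ℕ → C(X, ℝ)), (∀ i x, 0 ≤ φ i x) → (∀ x, ∑ i ∈ s, φ i x ≤ 1) →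
      ENNReal.ofReal (∫ x, ∑ i ∈ s, φ i x * f i x ∂lam) ≤ L) :
    ∫⁻ x, ⨆ i, ENNReal.ofReal (f i x) ∂lam ≤ L := by
  have hfinite (N : ℕ) :
      ∫⁻ x, ⨆ i, ⨆ _ : i < N, ENNReal.ofReal (f i x) ∂lam ≤ L := by
    obtain ⟨A, hA, hdisj, hAx⟩ := exists_measurable_subpartition_le_sum hf N
    let s := Finset.range N
    let t (i : ℕ) : X → ℝ := (A i).indicator 1
    have ht1 (x : X) : ∑ i ∈ s, t i x ≤ 1 := by
      by_cases hx : ∃ i ∈ s, x ∈ A i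
      · obtain ⟨i, hi, hxi⟩ := hx
        rw [Finset.sum_eq_single_of_mem i hi]
        · simp [t, hxi]
        · intro j _ hji
          exact Set.indicator_of_notMem
            (fun hxj => Set.disjoint_left.1 (hdisj hji) hxj hxi) _
      · push Not at hx
        rw [Finset.sum_eq_zero fun i hi => Set.indicator_of_notMem (hx i hi) _]
        exact zero_le_one
    obtain ⟨φ, hφ0, hφ1, hφ⟩ := exists_seq_continuousMap_subpartition_tendsto_ae (lam := lam) s
      (t := t) (fun i => (integrable_const (1 : ℝ)).indicator (hA i))
      (fun i x => Set.indicator_nonneg (fun _ _ => zero_le_one) x) ht1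
    have hφle (k i : ℕ) (hi : i ∈ s) (x : X) : φ k i x ≤ 1 :=
      (Finset.single_le_sum (f := fun i => φ k i x) (fun j _ => hφ0 k j x) hi).trans (hφ1 k x)
    have hlim : Tendsto (fun k => ∫ x, ∑ i ∈ s, φ k i x * f i x ∂lam) atTop
        (𝓝 (∫ x, ∑ i ∈ s, t i x * f i x ∂lam)) := by
      refine tendsto_integral_of_dominated_convergence (fun x => ∑ i ∈ s, |f i x|) ?_ ?_ ?_ ?_
      · intro k
        exact (Finset.measurable_fun_sum s fun i _ =>
          (φ k i).continuous.measurable.mul (hf i)).aestronglyMeasurable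
      · exact integrable_finsetSum s fun i _ => (hfi i).abs
      · refine fun k => Eventually.of_forall fun x => ?_
        refine (norm_sum_le _ _).trans (Finset.sum_le_sum fun i hi => ?_)
        rw [norm_mul, Real.norm_of_nonneg (hφ0 k i x), Real.norm_eq_abs]
        exact mul_le_of_le_one_left (abs_nonneg _) (hφle k i hi x)
      · filter_upwards [hφ] with x hx
        exact tendsto_finsetSum s fun i hi => (hx i hi).mul_const _
    have hsum (x : X) : ∑ i ∈ s, t i x * f i x = ∑ i ∈ s, (A i).indicator (f i) x := by
      refine Finset.sum_congr rfl fun i _ => ?_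
      by_cases hx : x ∈ A i <;> simp [t, hx]
    calc ∫⁻ x, ⨆ i, ⨆ _ : i < N, ENNReal.ofReal (f i x) ∂lam
        ≤ ∫⁻ x, ENNReal.ofReal (∑ i ∈ s, t i x * f i x) ∂lam :=
          lintegral_mono fun x => iSup₂_le fun i hi => by
            rw [hsum]
            exact ENNReal.ofReal_le_ofReal ((hAx x).2 i hi)
      _ = ENNReal.ofReal (∫ x, ∑ i ∈ s, t i x * f i x ∂lam) := by
          simp only [hsum]
          refine (ofReal_integral_eq_lintegral_ofReal
            (integrable_finsetSum s fun i _ => (hfi i).indicator (hA i))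
            (Eventually.of_forall fun x => Finset.sum_nonneg fun i _ => (hAx x).1 i)).symm
      _ ≤ L := le_of_tendsto (ENNReal.tendsto_ofReal hlim)
          (Eventually.of_forall fun k => hL s (φ k) (hφ0 k) (hφ1 k))
  have hiSup (x : X) : ⨆ i, ENNReal.ofReal (f i x) =
      ⨆ N, ⨆ i, ⨆ _ : i < N, ENNReal.ofReal (f i x) :=
    le_antisymm (iSup_le fun i => le_iSup_of_le (i + 1) <| le_iSup₂_of_le i i.lt_succ_self le_rfl)
      (iSup_le fun _ => iSup₂_le fun i _ => le_iSup (fun i => ENNReal.ofReal (f i x)) i)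
  simp only [hiSup]
  rw [lintegral_iSup]
  · exact iSup_le hfinite
  · exact fun N => Measurable.iSup fun i => Measurable.iSup fun _ => (hf i).ennreal_ofReal
  · exact fun N M hNM x => iSup₂_le fun i hi => le_iSup₂_of_le i (hi.trans_le hNM) le_rfl

end Approximation

lemma ofReal_integral_le_lintegral_ofReal {X : Type*} [MeasurableSpace X] {μ : Measure X}
    {f : X → ℝ} (hf : Integrable f μ) :
    ENNReal.ofReal (∫ x, f x ∂μ) ≤ ∫⁻ x, ENNReal.ofReal (f x) ∂μ := by
  have hpos : Integrable (fun x => max (f x) 0) μ := hf.pos_part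
  calc ENNReal.ofReal (∫ x, f x ∂μ) ≤ ENNReal.ofReal (∫ x, max (f x) 0 ∂μ) :=
        ENNReal.ofReal_le_ofReal (integral_mono hf hpos fun x => le_max_left _ _)
    _ = ∫⁻ x, ENNReal.ofReal (max (f x) 0) ∂μ :=
        ofReal_integral_eq_lintegral_ofReal hpos (Eventually.of_forall fun x => le_max_right _ _)
    _ = ∫⁻ x, ENNReal.ofReal (f x) ∂μ := by simp

section Affine

variable {d : ℕ}

/-- The affine function on `ℝ × ℝᵈ` with coefficients `p`. -/
noncomputable def affineEval (p : ℝ × EuclideanSpace ℝ (Fin d) × ℝ)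
    (s : ℝ) (v : EuclideanSpace ℝ (Fin d)) : ℝ :=
  p.1 * s + ⟪p.2.1, v⟫ + p.2.2

/-- The coefficients of the affine functions lying below `Psi D m`. -/
def psiMinorants (d : ℕ) (D : Set ℝ) (m : ℝ → ℝ) : Set (ℝ × EuclideanSpace ℝ (Fin d) × ℝ) :=
  {p | ∀ s v, ENNReal.ofReal (affineEval p s v) ≤ Psi D m s v}

variable {D : Set ℝ} {m : ℝ → ℝ}

lemma zero_mem_psiMinorants : (0 : ℝ × EuclideanSpace ℝ (Fin d) × ℝ) ∈ psiMinorants d D m := by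
  intro s v
  simp [affineEval]

lemma Psi_of_notMem {s : ℝ} (hs : s ∉ D) (v : EuclideanSpace ℝ (Fin d)) : Psi D m s v = ⊤ := by
  simp [Psi, hs]

lemma exists_minorant_of_notMem (hDclosed : IsClosed D) (hDconvex : Convex ℝ D) {s : ℝ}
    (hs : s ∉ D) (v : EuclideanSpace ℝ (Fin d)) {t : ℝ≥0∞} (ht : t < ⊤) :
    ∃ p ∈ psiMinorants d D m, t < ENNReal.ofReal (affineEval p s v) := by
  obtain ⟨f, c, hfs, hfD⟩ := geometric_hahn_banach_point_closed hDconvex hDclosed hs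
  have hlin (x : ℝ) : f x = f 1 * x := by
    rw [mul_comm, ← smul_eq_mul, ← map_smul, smul_eq_mul, mul_one]
  let k := (t.toReal + 1) / (c - f s)
  have hk : 0 ≤ k := div_nonneg (by positivity) (sub_pos.2 hfs).le
  have heval (x : ℝ) (v : EuclideanSpace ℝ (Fin d)) :
      affineEval (-(k * f 1), (0 : EuclideanSpace ℝ (Fin d)), k * c) x v = k * (c - f x) := by
    rw [hlin x]
    simp [affineEval]
    ring
  refine ⟨(-(k * f 1), 0, k * c), fun x v => ?_, ?_⟩
  · by_cases hx : x ∈ D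
    · rw [heval, ENNReal.ofReal_of_nonpos]
      · exact zero_le
      · exact mul_nonpos_of_nonneg_of_nonpos hk (sub_nonpos.2 (hfD x hx).le)
    · rw [Psi_of_notMem hx]
      exact le_top
  · rw [heval, ENNReal.lt_ofReal_iff_toReal_lt ht.ne,
      div_mul_cancel₀ _ (sub_pos.2 hfs).ne']
    exact lt_add_one _

lemma tangent_mem_psiMinorants (hm0 : ∀ u ∈ D, 0 ≤ m u) {p q : ℝ}
    (hpq : ∀ x ∈ D, m x ≤ p * x + q) (b : EuclideanSpace ℝ (Fin d)) :
    (-(‖b‖ ^ 2 * p), (2 : ℝ) • b, -(‖b‖ ^ 2 * q)) ∈ psiMinorants d D m := by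
  intro x v
  by_cases hx : x ∈ D
  swap
  · rw [Psi_of_notMem hx]
    exact le_top
  have heval : affineEval (-(‖b‖ ^ 2 * p), (2 : ℝ) • b, -(‖b‖ ^ 2 * q)) x v ≤
      2 * ⟪b, v⟫ - ‖b‖ ^ 2 * m x := by
    have := mul_le_mul_of_nonneg_left (hpq x hx) (sq_nonneg ‖b‖)
    simp only [affineEval, real_inner_smul_left]
    linarith
  obtain hpos | hzero := (hm0 x hx).lt_or_eq
  · rw [Psi, if_pos ⟨hx, hpos⟩]
    refine ENNReal.ofReal_le_ofReal (heval.trans ?_)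
    rw [le_div_iff₀ hpos]
    have hcs := mul_le_mul_of_nonneg_right (real_inner_le_norm b v) hpos.le
    nlinarith [sq_nonneg (‖b‖ * m x - ‖v‖)]
  · by_cases hv : v = 0
    · subst hv
      rw [ENNReal.ofReal_of_nonpos]
      · exact zero_le
      · simpa [← hzero] using heval
    · simp [Psi, ← hzero, hv]

lemma exists_gt_lt_ofReal_of_lt_Psi (hm0 : ∀ u ∈ D, 0 ≤ m u) {s : ℝ} (hs : s ∈ D)
    {v : EuclideanSpace ℝ (Fin d)} {t : ℝ≥0∞} (ht : t < Psi D m s v) :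
    ∃ a, m s < a ∧ t < ENNReal.ofReal (‖v‖ ^ 2 / a) := by
  obtain hpos | hzero := (hm0 s hs).lt_or_eq
  · rw [Psi, if_pos ⟨hs, hpos⟩] at ht
    have hcont : Tendsto (fun a => ENNReal.ofReal (‖v‖ ^ 2 / a)) (𝓝[>] (m s))
        (𝓝 (ENNReal.ofReal (‖v‖ ^ 2 / m s))) :=
      ENNReal.tendsto_ofReal
        ((tendsto_const_nhds.div tendsto_id hpos.ne').mono_left nhdsWithin_le_nhds)
    obtain ⟨a, ha, hta⟩ := ((eventually_mem_nhdsWithin (a := m s) (s := Set.Ioi (m s))).and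
      (hcont.eventually (lt_mem_nhds ht))).exists
    exact ⟨a, ha, hta⟩
  · have hv : v ≠ 0 := by
      rintro rfl
      simp [Psi, hs, ← hzero] at ht
    have hv2 : 0 < ‖v‖ ^ 2 := by positivity
    refine ⟨‖v‖ ^ 2 / (t.toReal + 1), by rw [← hzero]; positivity, ?_⟩
    rw [ENNReal.lt_ofReal_iff_toReal_lt ht.ne_top, div_div_cancel₀ hv2.ne']
    exact lt_add_one _

lemma exists_minorant_of_lt_Psi (hDclosed : IsClosed D) (hDconvex : Convex ℝ D)
    (hconc : ConcaveOn ℝ D m) (hm0 : ∀ u ∈ D, 0 ≤ m u)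
    (husc : ∀ c : ℝ, IsClosed {u : ℝ | u ∈ D ∧ c ≤ m u})
    {s : ℝ} {v : EuclideanSpace ℝ (Fin d)} {t : ℝ≥0∞} (ht : t < Psi D m s v) :
    ∃ p ∈ psiMinorants d D m, t < ENNReal.ofReal (affineEval p s v) := by
  by_cases hs : s ∈ D
  swap
  · exact exists_minorant_of_notMem hDclosed hDconvex hs v ht.lt_top
  obtain ⟨a, hma, hta⟩ := exists_gt_lt_ofReal_of_lt_Psi hm0 hs ht
  have ha : 0 < a := (hm0 s hs).trans_lt hma
  have hlsc : LowerSemicontinuousOn (-m) D := by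
    intro x hx y hy
    have hmem : x ∈ {u : ℝ | u ∈ D ∧ -y ≤ m u}ᶜ := fun h => by
      have := h.2
      simp only [Pi.neg_apply] at hy
      linarith
    filter_upwards [self_mem_nhdsWithin,
      nhdsWithin_le_nhds ((husc (-y)).isOpen_compl.mem_nhds hmem)] with z hz hz'
    by_contra! h
    exact hz' ⟨hz, by simp only [Pi.neg_apply] at h; linarith⟩
  obtain ⟨p, q, hpq, hpqs⟩ := hconc.neg.exists_affine_le_of_lt_real (a := -a) hs
    (by simpa using hma) hDclosed hlsc
  refine ⟨_, tangent_mem_psiMinorants hm0 (p := -p) (q := -q) (fun x hx => ?_) (a⁻¹ • v),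
    hta.trans_eq (congrArg ENNReal.ofReal ?_)⟩
  · have := hpq x hx
    simp only [Pi.neg_apply] at this
    linarith
  · have hq : q = -a - p * s := by linarith
    simp only [affineEval, real_inner_smul_left, real_inner_self_eq_norm_sq, norm_smul, norm_inv,
      Real.norm_of_nonneg ha.le, hq]
    field_simp
    ring

/-- `Psi D m` is the supremum of a sequence of affine minorants. -/
lemma exists_seq_minorants_le_iSup (hDclosed : IsClosed D) (hDconvex : Convex ℝ D)
    (hconc : ConcaveOn ℝ D m) (hm0 : ∀ u ∈ D, 0 ≤ m u)
    (husc : ∀ c : ℝ, IsClosed {u : ℝ | u ∈ D ∧ c ≤ m u}) :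
    ∃ p : ℕ → ℝ × EuclideanSpace ℝ (Fin d) × ℝ, (∀ i, p i ∈ psiMinorants d D m) ∧
      ∀ s v, Psi D m s v ≤ ⨆ i, ENNReal.ofReal (affineEval (p i) s v) := by
  have : Nonempty (psiMinorants d D m) := ⟨⟨0, zero_mem_psiMinorants⟩⟩
  obtain ⟨p, hp⟩ := TopologicalSpace.exists_dense_seq (psiMinorants d D m)
  refine ⟨fun i => p i, fun i => (p i).2, fun s v => le_of_forall_lt fun t ht => ?_⟩
  obtain ⟨q, hq, htq⟩ := exists_minorant_of_lt_Psi hDclosed hDconvex hconc hm0 husc ht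
  have hcont : Continuous fun r : psiMinorants d D m =>
      ENNReal.ofReal (affineEval (r : ℝ × EuclideanSpace ℝ (Fin d) × ℝ) s v) := by
    refine ENNReal.continuous_ofReal.comp ?_
    unfold affineEval
    fun_prop
  obtain ⟨i, hi⟩ := hp.exists_mem_open (isOpen_lt continuous_const hcont) ⟨⟨q, hq⟩, htq⟩
  exact lt_of_lt_of_le hi (le_iSup (fun i => ENNReal.ofReal (affineEval (p i).1 s v)) i)

end Affine

section WeakConvergence

lemma ContinuousMap.integrable_mul {X : Type*} [TopologicalSpace X] [CompactSpace X]
    [MeasurableSpace X] [OpensMeasurableSpace X] {μ : Measure X} (φ : C(X, ℝ)) {f : X → ℝ}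
    (hf : Integrable f μ) : Integrable (fun x => φ x * f x) μ :=
  hf.bdd_mul φ.continuous.aestronglyMeasurable (Eventually.of_forall φ.norm_coe_le_norm)

lemma integrable_affineEval {d : ℕ} {X : Type*} [MeasurableSpace X] {μ : Measure X}
    [IsFiniteMeasure μ] (p : ℝ × EuclideanSpace ℝ (Fin d) × ℝ) {u : X → ℝ}
    {w : X → EuclideanSpace ℝ (Fin d)} (hu : Integrable u μ) (hw : Integrable w μ) :
    Integrable (fun x => affineEval p (u x) (w x)) μ :=
  ((hu.const_mul _).add (hw.const_inner _)).add (integrable_const _)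

variable {d : ℕ} {X : Type*} [MetricSpace X] [CompactSpace X] [MeasurableSpace X] [BorelSpace X]
  {lam : Measure X} [IsFiniteMeasure lam]

lemma integral_mul_affineEval (p : ℝ × EuclideanSpace ℝ (Fin d) × ℝ) (φ : C(X, ℝ)) {u : X → ℝ}
    {w : X → EuclideanSpace ℝ (Fin d)} (hu : Integrable u lam) (hw : Integrable w lam) :
    ∫ x, φ x * affineEval p (u x) (w x) ∂lam =
      p.1 * ∫ x, φ x * u x ∂lam + ∫ x, ⟪φ x • p.2.1, w x⟫ ∂lam + ∫ x, φ x * p.2.2 ∂lam := by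
  have h1 := (φ.integrable_mul hu).const_mul p.1
  have h2 : Integrable (fun x => ⟪φ x • p.2.1, w x⟫) lam := by
    simpa only [real_inner_smul_left] using φ.integrable_mul (hw.const_inner p.2.1)
  have h12 : Integrable (fun x => p.1 * (φ x * u x) + ⟪φ x • p.2.1, w x⟫) lam := h1.add h2
  rw [← integral_const_mul, ← integral_add h1 h2,
    ← integral_add h12 (φ.integrable_mul (integrable_const _))]
  refine integral_congr_ae (Eventually.of_forall fun x => ?_)
  simp only [affineEval, real_inner_smul_left]
  ring

lemma tendsto_integral_mul_affineEval {un : ℕ → X → ℝ} {u : X → ℝ}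
    {wn : ℕ → X → EuclideanSpace ℝ (Fin d)} {w : X → EuclideanSpace ℝ (Fin d)}
    (hun : ∀ n, Integrable (un n) lam) (hu : Integrable u lam)
    (hwn : ∀ n, Integrable (wn n) lam) (hw : Integrable w lam)
    (hweak_u : ∀ φ : C(X, ℝ),
      Tendsto (fun n => ∫ x, φ x * un n x ∂lam) atTop (𝓝 (∫ x, φ x * u x ∂lam)))
    (hweak_w : ∀ Φ : C(X, EuclideanSpace ℝ (Fin d)),
      Tendsto (fun n => ∫ x, ⟪Φ x, wn n x⟫ ∂lam) atTop (𝓝 (∫ x, ⟪Φ x, w x⟫ ∂lam)))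
    (p : ℝ × EuclideanSpace ℝ (Fin d) × ℝ) (φ : C(X, ℝ)) :
    Tendsto (fun n => ∫ x, φ x * affineEval p (un n x) (wn n x) ∂lam) atTop
      (𝓝 (∫ x, φ x * affineEval p (u x) (w x) ∂lam)) := by
  rw [integral_mul_affineEval p φ hu hw]
  simp only [fun n => integral_mul_affineEval p φ (hun n) (hwn n)]
  exact (((hweak_u φ).const_mul _).add
    (hweak_w ⟨fun x => φ x • p.2.1, by fun_prop⟩)).add tendsto_const_nhds

/-- The integral of an affine minorant localized by a subpartition of unity is below the action. -/
lemma ofReal_integral_sum_le_lintegral_Psi {D : Set ℝ} {m : ℝ → ℝ}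
    {p : ℕ → ℝ × EuclideanSpace ℝ (Fin d) × ℝ} (hp : ∀ i, p i ∈ psiMinorants d D m)
    {s : Finset ℕ} {φ : ℕ → C(X, ℝ)} (hφ0 : ∀ i x, 0 ≤ φ i x) (hφ1 : ∀ x, ∑ i ∈ s, φ i x ≤ 1)
    {u : X → ℝ} {w : X → EuclideanSpace ℝ (Fin d)}
    (hu : Integrable u lam) (hw : Integrable w lam) :
    ENNReal.ofReal (∫ x, ∑ i ∈ s, φ i x * affineEval (p i) (u x) (w x) ∂lam) ≤
      ∫⁻ x, Psi D m (u x) (w x) ∂lam := by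
  refine (ofReal_integral_le_lintegral_ofReal (integrable_finsetSum s fun i _ =>
    (φ i).integrable_mul (integrable_affineEval (p i) hu hw))).trans (lintegral_mono fun x => ?_)
  obtain htop | htop := eq_or_ne (Psi D m (u x) (w x)) ⊤
  · rw [htop]
    exact le_top
  refine ENNReal.ofReal_le_of_le_toReal ?_
  calc ∑ i ∈ s, φ i x * affineEval (p i) (u x) (w x)
      ≤ ∑ i ∈ s, φ i x * (Psi D m (u x) (w x)).toReal :=
        Finset.sum_le_sum fun i _ => mul_le_mul_of_nonneg_left
          ((ENNReal.ofReal_le_iff_le_toReal htop).1 (hp i (u x) (w x))) (hφ0 i x)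
    _ ≤ (Psi D m (u x) (w x)).toReal := by
        rw [← Finset.sum_mul]
        exact mul_le_of_le_one_left ENNReal.toReal_nonneg (hφ1 x)

end WeakConvergence

/-- lower semicontinuity of the Benamou–Brenier-type action with nonlinear
mobility along sequences of densities converging weakly (against continuous test
functions) with respect to a finite reference measure on a compact metric space. -/
theorem action_integral_lower_semicontinuous {d : ℕ} {X : Type*} [MetricSpace X]
    [CompactSpace X] [MeasurableSpace X] [BorelSpace X]
    (lam : Measure X) [IsFiniteMeasure lam]
    (D : Set ℝ) (hDclosed : IsClosed D) (hDconvex : Convex ℝ D)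
    (m : ℝ → ℝ) (hconc : ConcaveOn ℝ D m) (hm0 : ∀ u ∈ D, 0 ≤ m u)
    (husc : ∀ c : ℝ, IsClosed {u : ℝ | u ∈ D ∧ c ≤ m u})
    (un : ℕ → X → ℝ) (u : X → ℝ)
    (wn : ℕ → X → EuclideanSpace ℝ (Fin d)) (w : X → EuclideanSpace ℝ (Fin d))
    (hun : ∀ n, Integrable (un n) lam) (hu : Integrable u lam)
    (hwn : ∀ n, Integrable (wn n) lam) (hw : Integrable w lam)
    (hweak_u : ∀ φ : C(X, ℝ),
      Tendsto (fun n => ∫ x, φ x * un n x ∂lam) atTop (𝓝 (∫ x, φ x * u x ∂lam)))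
    (hweak_w : ∀ Φ : C(X, EuclideanSpace ℝ (Fin d)),
      Tendsto (fun n => ∫ x, ⟪Φ x, wn n x⟫ ∂lam) atTop
        (𝓝 (∫ x, ⟪Φ x, w x⟫ ∂lam))) :
    ∫⁻ x, Psi D m (u x) (w x) ∂lam ≤
      atTop.liminf (fun n => ∫⁻ x, Psi D m (un n x) (wn n x) ∂lam) := by
  obtain ⟨p, hp, hpsup⟩ := exists_seq_minorants_le_iSup (d := d) hDclosed hDconvex hconc hm0 husc
  let u' := hu.1.mk u
  let w' := hw.1.mk w
  have huu' : u =ᵐ[lam] u' := hu.1.ae_eq_mk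
  have hww' : w =ᵐ[lam] w' := hw.1.ae_eq_mk
  have hu'm : Measurable u' := hu.1.stronglyMeasurable_mk.measurable
  have hw'm : Measurable w' := hw.1.stronglyMeasurable_mk.measurable
  have hu' : Integrable u' lam := hu.congr huu'
  have hw' : Integrable w' lam := hw.congr hww'
  calc ∫⁻ x, Psi D m (u x) (w x) ∂lam
      ≤ ∫⁻ x, ⨆ i, ENNReal.ofReal (affineEval (p i) (u' x) (w' x)) ∂lam := by
        refine lintegral_mono_ae ?_
        filter_upwards [huu', hww'] with x hx hx'
        rw [← hx, ← hx']
        exact hpsup _ _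
    _ ≤ atTop.liminf (fun n => ∫⁻ x, Psi D m (un n x) (wn n x) ∂lam) := by
        refine lintegral_iSup_ofReal_le_of_subpartition
          (f := fun i x => affineEval (p i) (u' x) (w' x))
          (fun i => by unfold affineEval; fun_prop)
          (fun i => integrable_affineEval (p i) hu' hw') fun s φ hφ0 hφ1 => ?_
        have hlim : Tendsto
            (fun n => ∫ x, ∑ i ∈ s, φ i x * affineEval (p i) (un n x) (wn n x) ∂lam) atTop
            (𝓝 (∫ x, ∑ i ∈ s, φ i x * affineEval (p i) (u' x) (w' x) ∂lam)) := by
          have hae : ∫ x, ∑ i ∈ s, φ i x * affineEval (p i) (u' x) (w' x) ∂lam =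
              ∫ x, ∑ i ∈ s, φ i x * affineEval (p i) (u x) (w x) ∂lam := by
            refine integral_congr_ae ?_
            filter_upwards [huu', hww'] with x hx hx'
            rw [hx, hx']
          rw [hae, integral_finsetSum s fun i _ =>
            (φ i).integrable_mul (integrable_affineEval (p i) hu hw)]
          simp only [fun n => integral_finsetSum s fun i _ =>
            (φ i).integrable_mul (integrable_affineEval (p i) (hun n) (hwn n))]
          exact tendsto_finsetSum s fun i _ =>
            tendsto_integral_mul_affineEval hun hu hwn hw hweak_u hweak_w (p i) (φ i)
        rw [← (ENNReal.tendsto_ofReal hlim).liminf_eq]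
        exact liminf_le_liminf (Eventually.of_forall fun n =>
          ofReal_integral_sum_le_lintegral_Psi hp hφ0 hφ1 (hun n) (hwn n))
end

section
/- Let (X, Σ, λ) be a finite measure space, D ⊆ ℝ, m : ℝ → ℝ with m ≥ 0 on D, and m_max > 0 a constant. Let u : X → ℝ and w : X → ℝ^d be measurable, and assume that for λ-almost every x ∈ X one has u(x) ∈ D and m(u(x)) ≤ m_max. Then (∫_X ‖w(x)‖ dλ(x))² ≤ m_max · λ(X) · ∫_X Ψ(u(x), w(x)) dλ(x), as an inequality in [0,+∞]. -/
open MeasureTheory Filter Topology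
open scoped ENNReal Classical

theorem sq_lintegral_le_measure_univ_mul_lintegral_sq {X : Type*} [MeasurableSpace X]
    (μ : Measure X) {f : X → ℝ≥0∞} (hf : AEMeasurable f μ) :
    (∫⁻ x, f x ∂μ) ^ 2 ≤ μ Set.univ * ∫⁻ x, f x ^ 2 ∂μ := by
  have h := ENNReal.lintegral_mul_le_Lp_mul_Lq μ Real.HolderConjugate.two_two
    (aemeasurable_const (b := (1 : ℝ≥0∞))) hf
  simp only [Pi.mul_apply, one_mul, one_pow, lintegral_const, ENNReal.rpow_two] at h
  calc (∫⁻ x, f x ∂μ) ^ 2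
      ≤ (μ Set.univ ^ (1 / 2 : ℝ) * (∫⁻ x, f x ^ 2 ∂μ) ^ (1 / 2 : ℝ)) ^ 2 :=
        pow_le_pow_left₀ zero_le h 2
    _ = μ Set.univ * ∫⁻ x, f x ^ 2 ∂μ := by
        rw [mul_pow, ← ENNReal.rpow_two, ← ENNReal.rpow_two, ← ENNReal.rpow_mul,
          ← ENNReal.rpow_mul]
        norm_num

theorem ofReal_norm_sq_le_mul_Psi {d : ℕ} {D : Set ℝ} {m : ℝ → ℝ} {mmax : ℝ}
    (hmmax : 0 < mmax) {u : ℝ} (hu : m u ≤ mmax) (v : EuclideanSpace ℝ (Fin d)) :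
    ENNReal.ofReal ‖v‖ ^ 2 ≤ ENNReal.ofReal mmax * Psi D m u v := by
  unfold Psi
  split_ifs with h₁ h₂
  · rw [← ENNReal.ofReal_pow (norm_nonneg v), ← ENNReal.ofReal_mul hmmax.le]
    apply ENNReal.ofReal_le_ofReal
    rw [mul_div_assoc', le_div_iff₀ h₁.2, mul_comm]
    gcongr
  · simp [h₂.2.2]
  · simp [ENNReal.mul_top, hmmax]

/-- Cauchy–Schwarz estimate bounding the total variation of the momentum
field by the action: `(∫ ‖w‖ dλ)² ≤ m_max · λ(X) · ∫ Ψ(u, w) dλ` whenever `u` takes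
values in `D` and `m ∘ u ≤ m_max` almost everywhere. -/
theorem momentum_bound_by_action {d : ℕ} {X : Type*} [MeasurableSpace X]
    (lam : Measure X) [IsFiniteMeasure lam]
    (D : Set ℝ) (m : ℝ → ℝ) (hm0 : ∀ u ∈ D, 0 ≤ m u)
    (mmax : ℝ) (hmmax : 0 < mmax)
    (u : X → ℝ) (w : X → EuclideanSpace ℝ (Fin d))
    (hu : Measurable u) (hw : Measurable w)
    (hae : ∀ᵐ x ∂lam, u x ∈ D ∧ m (u x) ≤ mmax) :
    (∫⁻ x, ENNReal.ofReal ‖w x‖ ∂lam) ^ 2 ≤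
      ENNReal.ofReal mmax * lam Set.univ * ∫⁻ x, Psi D m (u x) (w x) ∂lam := by
  calc (∫⁻ x, ENNReal.ofReal ‖w x‖ ∂lam) ^ 2
      ≤ lam Set.univ * ∫⁻ x, ENNReal.ofReal ‖w x‖ ^ 2 ∂lam :=
        sq_lintegral_le_measure_univ_mul_lintegral_sq lam hw.norm.ennreal_ofReal.aemeasurable
    _ ≤ lam Set.univ * ∫⁻ x, ENNReal.ofReal mmax * Psi D m (u x) (w x) ∂lam := by
        refine mul_le_mul_right ?_ _
        refine lintegral_mono_ae ?_
        filter_upwards [hae] with x hx using ofReal_norm_sq_le_mul_Psi hmmax hx.2 (w x)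
    _ = ENNReal.ofReal mmax * lam Set.univ * ∫⁻ x, Psi D m (u x) (w x) ∂lam := by
        rw [lintegral_const_mul' _ _ ENNReal.ofReal_ne_top]
        ring
end

section
/- Consider the embedded star-shaped graph and densities as in the context, and assume: (Bulk equation) for every φ ∈ C¹([0,1] × ℝ^d; ℝ), ∫₀¹∫_Ω ∂_tφ(t,x) u(t,x) dλ_Ω(x) dt + ∫₀¹∫_Ω ⟨∇_xφ(t,x), w(t,x)⟩ dλ_Ω(x) dt − Σ_{i=1}^{N−1} ∫₀¹∫₀¹ φ(t,γ_i(s)) f_i(t,s) ds dt + Σ_{i=1}^{N−1} ∫₀¹ φ(t,x_i) g_i(t) dt = ∫_Ω φ(1,x) u(1,x) dλ_Ω(x) − ∫_Ω φ(0,x) u(0,x) dλ_Ω(x); and (Graph equation) for every family ψ = (ψ_i)_{i=1}^{N−1} with ψ_i ∈ C¹([0,1] × [0,1]; ℝ) satisfying the continuity condition ψ_i(t,0) = ψ_j(t,0) for all i, j and all t ∈ [0,1], Σ_{i=1}^{N−1} ( ∫₀¹∫₀¹ ∂_tψ_i(t,s) ρ_i(t,s) ds dt + ∫₀¹∫₀¹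 ∂_sψ_i(t,s) V_i(t,s) ds dt + ∫₀¹∫₀¹ ψ_i(t,s) f_i(t,s) ds dt ) − Σ_{i=1}^{N−1} ∫₀¹ ψ_i(t,1) g_i(t) dt = Σ_{i=1}^{N−1} ( ∫₀¹ ψ_i(1,s) ρ_i(1,s) ds − ∫₀¹ ψ_i(0,s) ρ_i(0,s) ds ). Then the combined bulk-and-graph system satisfies a single global continuity equation: for every φ ∈ C¹([0,1] × ℝ^d; ℝ), ∫₀¹ ( ∫_Ω ∂_tφ(t,x) u(t,x) dλ_Ω(x) + Σ_{i=1}^{N−1} ∫₀¹ ∂_tφ(t,γ_i(s)) ρ_i(t,s) ds ) dt + ∫₀¹ ( ∫_Ω ⟨∇_xφ(t,x), w(t,x)⟩ dλ_Ω(x) + Σ_{i=1}^{N−1} ∫₀¹ ⟨∇_xφ(t,γ_i(s)), x_i − x₀⟩ V_i(t,s) ds ) dt = ( ∫_Ω φ(1,x) u(1,x) dλ_Ω(x) + Σ_{i=1}^{N−1} ∫₀¹ φ(1,γ_i(s)) ρ_i(1,s) ds ) − ( ∫_Ω φ(0,x) u(0,x) dλ_Ω(x) + Σ_{i=1}^{N−1}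 ∫₀¹ φ(0,γ_i(s)) ρ_i(0,s) ds ). -/
open MeasureTheory Filter Topology Set
open scoped ENNReal Classical RealInnerProductSpace

section Calculus

variable {E : Type*} [NormedAddCommGroup E]

/-- The time derivative of a jointly differentiable function is a directional derivative. -/
lemma deriv_slice_eq_fderiv [NormedSpace ℝ E] {φ : ℝ → E → ℝ}
    (hφ : Differentiable ℝ (fun p : ℝ × E => φ p.1 p.2)) (t : ℝ) (y : E) :
    deriv (fun τ => φ τ y) t = fderiv ℝ (fun p : ℝ × E => φ p.1 p.2) (t, y) (1, 0) := by
  have h : HasDerivAt (fun τ : ℝ => ((τ, y) : ℝ × E)) (1, 0) t :=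
    (hasDerivAt_id t).prodMk (hasDerivAt_const t y)
  exact ((hφ (t, y)).hasFDerivAt.comp_hasDerivAt t h).deriv

/-- The space derivative of a jointly differentiable function in terms of its total derivative. -/
lemma hasFDerivAt_slice [NormedSpace ℝ E] {φ : ℝ → E → ℝ}
    (hφ : Differentiable ℝ (fun p : ℝ × E => φ p.1 p.2)) (t : ℝ) (y : E) :
    HasFDerivAt (φ t) ((fderiv ℝ (fun p : ℝ × E => φ p.1 p.2) (t, y)).comp
      (ContinuousLinearMap.inr ℝ ℝ E)) y :=
  (hφ (t, y)).hasFDerivAt.comp y (hasFDerivAt_prodMk_right t y)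

lemma continuous_deriv_slice [NormedSpace ℝ E] {φ : ℝ → E → ℝ}
    (hφ : ContDiff ℝ 1 (fun p : ℝ × E => φ p.1 p.2)) :
    Continuous (fun p : ℝ × E => deriv (fun τ => φ τ p.2) p.1) := by
  simp_rw [deriv_slice_eq_fderiv (hφ.differentiable one_ne_zero)]
  exact (hφ.continuous_fderiv one_ne_zero).clm_apply continuous_const

lemma continuous_gradient_slice [InnerProductSpace ℝ E] [CompleteSpace E] {φ : ℝ → E → ℝ}
    (hφ : ContDiff ℝ 1 (fun p : ℝ × E => φ p.1 p.2)) :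
    Continuous (fun p : ℝ × E => gradient (φ p.1) p.2) := by
  simp_rw [gradient, (hasFDerivAt_slice (hφ.differentiable one_ne_zero) _ _).fderiv]
  exact (InnerProductSpace.toDual ℝ E).symm.continuous.comp
    ((hφ.continuous_fderiv one_ne_zero).clm_comp continuous_const)

/-- The chain rule along a segment, expressed with the gradient. -/
lemma deriv_comp_segment [InnerProductSpace ℝ E] [CompleteSpace E] {h : E → ℝ}
    (hh : Differentiable ℝ h) (a v : E) (s : ℝ) :
    deriv (fun σ : ℝ => h (a + σ • v)) s = ⟪gradient h (a + s • v), v⟫ := by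
  have hγ : HasDerivAt (fun σ : ℝ => a + σ • v) v s := by
    simpa using ((hasDerivAt_id s).smul_const v).const_add a
  rw [gradient, InnerProductSpace.toDual_symm_apply]
  exact ((hh _).hasFDerivAt.comp_hasDerivAt s hγ).deriv

end Calculus

section Integrability

variable {X : Type*} [TopologicalSpace X] [MeasurableSpace X] [OpensMeasurableSpace X]
  {μ : Measure X} {K : Set X}

/-- Pairing an integrable vector field with a continuous one on a compact set. -/
lemma MeasureTheory.IntegrableOn.continuous_inner {E : Type*} [NormedAddCommGroup E]
    [InnerProductSpace ℝ E] [SecondCountableTopologyEither X E] {G F : X → E}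
    (hF : IntegrableOn F K μ) (hG : Continuous G)
    (hK : IsCompact K) (hKm : MeasurableSet K) :
    IntegrableOn (fun p => ⟪G p, F p⟫) K μ := by
  obtain ⟨C, hC⟩ := hK.exists_bound_of_continuousOn hG.continuousOn
  refine Integrable.mono' (hF.norm.const_mul C)
    (hG.aestronglyMeasurable.inner hF.aestronglyMeasurable) ?_
  filter_upwards [ae_restrict_mem hKm] with p hp
  exact (norm_inner_le_norm _ _).trans
    (mul_le_mul_of_nonneg_right (hC p hp) (norm_nonneg _))

end Integrability

/-- a weak solution of the coupled system of continuity equations on the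
bulk domain `Ω` and on the embedded star-shaped graph with center `x 0`, edges
`γ_i(s) = x 0 + s • (x i - x 0)` for `i = 1, …, N-1`, edge densities `ρ_i, V_i, f_i`
and vertex fluxes `g_i`, satisfies the global continuity equation for the combined
bulk-and-graph mass and momentum. -/
theorem coupled_solution_satisfies_global_continuity_equation {d : ℕ}
    (Ω : Set (EuclideanSpace ℝ (Fin d))) (hΩc : IsCompact Ω) (hΩconv : Convex ℝ Ω)
    (lamΩ : Measure (EuclideanSpace ℝ (Fin d))) [IsFiniteMeasure lamΩ]
    (N : ℕ) (hN : 2 ≤ N)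
    (x : ℕ → EuclideanSpace ℝ (Fin d)) (hxΩ : ∀ i < N, x i ∈ Ω)
    (hxdist : ∀ i < N, ∀ j < N, i ≠ j → x i ≠ x j)
    (u : ℝ → EuclideanSpace ℝ (Fin d) → ℝ)
    (w : ℝ → EuclideanSpace ℝ (Fin d) → EuclideanSpace ℝ (Fin d))
    (ρ V f : ℕ → ℝ → ℝ → ℝ) (g : ℕ → ℝ → ℝ)
    -- regularity of the densities
    (hu_meas : Measurable (Function.uncurry u)) (hu_bdd : ∃ C : ℝ, ∀ t y, |u t y| ≤ C)
    (hw_int : Integrable (fun p : ℝ × EuclideanSpace ℝ (Fin d) => w p.1 p.2)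
      ((volume.restrict (Icc (0 : ℝ) 1)).prod (lamΩ.restrict Ω)))
    (hρ_int : ∀ i, Integrable (fun p : ℝ × ℝ => ρ i p.1 p.2)
      ((volume.restrict (Icc (0 : ℝ) 1)).prod (volume.restrict (Icc (0 : ℝ) 1))))
    (hV_int : ∀ i, Integrable (fun p : ℝ × ℝ => V i p.1 p.2)
      ((volume.restrict (Icc (0 : ℝ) 1)).prod (volume.restrict (Icc (0 : ℝ) 1))))
    (hf_int : ∀ i, Integrable (fun p : ℝ × ℝ => f i p.1 p.2)
      ((volume.restrict (Icc (0 : ℝ) 1)).prod (volume.restrict (Icc (0 : ℝ) 1))))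
    (hg_int : ∀ i, IntegrableOn (g i) (Icc (0 : ℝ) 1))
    -- (Bulk equation)
    (hBulk : ∀ φ : ℝ → EuclideanSpace ℝ (Fin d) → ℝ,
      ContDiff ℝ 1 (fun p : ℝ × EuclideanSpace ℝ (Fin d) => φ p.1 p.2) →
      (∫ t in Icc (0 : ℝ) 1, ∫ y in Ω, deriv (fun τ => φ τ y) t * u t y ∂lamΩ) +
        (∫ t in Icc (0 : ℝ) 1, ∫ y in Ω, ⟪gradient (φ t) y, w t y⟫ ∂lamΩ) -
        (∑ i ∈ Finset.Ico 1 N, ∫ t in Icc (0 : ℝ) 1, ∫ s in Icc (0 : ℝ) 1,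
          φ t (x 0 + s • (x i - x 0)) * f i t s) +
        (∑ i ∈ Finset.Ico 1 N, ∫ t in Icc (0 : ℝ) 1, φ t (x i) * g i t) =
      (∫ y in Ω, φ 1 y * u 1 y ∂lamΩ) - (∫ y in Ω, φ 0 y * u 0 y ∂lamΩ))
    -- (Graph equation)
    (hGraph : ∀ ψ : ℕ → ℝ → ℝ → ℝ,
      (∀ i, ContDiff ℝ 1 (fun p : ℝ × ℝ => ψ i p.1 p.2)) →
      (∀ i j t, ψ i t 0 = ψ j t 0) →
      (∑ i ∈ Finset.Ico 1 N,
        ((∫ t in Icc (0 : ℝ) 1, ∫ s in Icc (0 : ℝ) 1,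
            deriv (fun τ => ψ i τ s) t * ρ i t s) +
          (∫ t in Icc (0 : ℝ) 1, ∫ s in Icc (0 : ℝ) 1,
            deriv (fun σ => ψ i t σ) s * V i t s) +
          (∫ t in Icc (0 : ℝ) 1, ∫ s in Icc (0 : ℝ) 1, ψ i t s * f i t s))) -
        (∑ i ∈ Finset.Ico 1 N, ∫ t in Icc (0 : ℝ) 1, ψ i t 1 * g i t) =
      ∑ i ∈ Finset.Ico 1 N,
        ((∫ s in Icc (0 : ℝ) 1, ψ i 1 s * ρ i 1 s) -
          (∫ s in Icc (0 : ℝ) 1, ψ i 0 s * ρ i 0 s))) :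
    -- global continuity equation for the combined system
    ∀ φ : ℝ → EuclideanSpace ℝ (Fin d) → ℝ,
      ContDiff ℝ 1 (fun p : ℝ × EuclideanSpace ℝ (Fin d) => φ p.1 p.2) →
      (∫ t in Icc (0 : ℝ) 1,
        ((∫ y in Ω, deriv (fun τ => φ τ y) t * u t y ∂lamΩ) +
          ∑ i ∈ Finset.Ico 1 N, ∫ s in Icc (0 : ℝ) 1,
            deriv (fun τ => φ τ (x 0 + s • (x i - x 0))) t * ρ i t s)) +
      (∫ t in Icc (0 : ℝ) 1,
        ((∫ y in Ω, ⟪gradient (φ t) y, w t y⟫ ∂lamΩ) +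
          ∑ i ∈ Finset.Ico 1 N, ∫ s in Icc (0 : ℝ) 1,
            ⟪gradient (φ t) (x 0 + s • (x i - x 0)), x i - x 0⟫ * V i t s)) =
      ((∫ y in Ω, φ 1 y * u 1 y ∂lamΩ) +
        ∑ i ∈ Finset.Ico 1 N, ∫ s in Icc (0 : ℝ) 1,
          φ 1 (x 0 + s • (x i - x 0)) * ρ i 1 s) -
      ((∫ y in Ω, φ 0 y * u 0 y ∂lamΩ) +
        ∑ i ∈ Finset.Ico 1 N, ∫ s in Icc (0 : ℝ) 1,
          φ 0 (x 0 + s • (x i - x 0)) * ρ i 0 s) := by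
  intro φ hφ
  have hdiff := hφ.differentiable one_ne_zero
  obtain ⟨C, hC⟩ := hu_bdd
  have hγ : ∀ i, ContDiff ℝ 1 (fun p : ℝ × ℝ => (p.1, x 0 + p.2 • (x i - x 0))) := fun i => by
    fun_prop
  have hψ : ∀ i, ContDiff ℝ 1 (fun p : ℝ × ℝ => φ p.1 (x 0 + p.2 • (x i - x 0))) := fun i =>
    hφ.comp (hγ i)
  have hK : IsCompact (Icc (0 : ℝ) 1 ×ˢ Ω) := isCompact_Icc.prod hΩc
  have hQ : IsCompact (Icc (0 : ℝ) 1 ×ˢ Icc (0 : ℝ) 1) := isCompact_Icc.prod isCompact_Icc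
  have hKm : MeasurableSet (Icc (0 : ℝ) 1 ×ˢ Ω) := measurableSet_Icc.prod hΩc.measurableSet
  have hQm : MeasurableSet (Icc (0 : ℝ) 1 ×ˢ Icc (0 : ℝ) 1) :=
    measurableSet_Icc.prod measurableSet_Icc
  have hbulk_mass : Integrable (fun t => ∫ y in Ω, deriv (fun τ => φ τ y) t * u t y ∂lamΩ)
      (volume.restrict (Icc (0 : ℝ) 1)) := by
    have hu : Integrable (Function.uncurry u)
        ((volume.restrict (Icc (0 : ℝ) 1)).prod (lamΩ.restrict Ω)) :=
      Integrable.of_bound hu_meas.aestronglyMeasurable C (ae_of_all _ fun p => hC p.1 p.2)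
    rw [Measure.prod_restrict] at hu
    have h := IntegrableOn.continuousOn_mul (continuous_deriv_slice hφ).continuousOn hu hK
    rw [IntegrableOn, ← Measure.prod_restrict] at h
    exact h.integral_prod_left
  have hbulk_flux : Integrable (fun t => ∫ y in Ω, ⟪gradient (φ t) y, w t y⟫ ∂lamΩ)
      (volume.restrict (Icc (0 : ℝ) 1)) := by
    rw [Measure.prod_restrict] at hw_int
    have h := IntegrableOn.continuous_inner hw_int (continuous_gradient_slice hφ) hK hKm
    rw [IntegrableOn, ← Measure.prod_restrict] at h
    exact h.integral_prod_left
  have hedge_mass : ∀ i, Integrable (fun t => ∫ s in Icc (0 : ℝ) 1,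
      deriv (fun τ => φ τ (x 0 + s • (x i - x 0))) t * ρ i t s)
      (volume.restrict (Icc (0 : ℝ) 1)) := fun i => by
    have hi := hρ_int i
    rw [Measure.prod_restrict] at hi
    have h := IntegrableOn.continuousOn_mul
      ((continuous_deriv_slice hφ).comp (hγ i).continuous).continuousOn hi hQ
    rw [IntegrableOn, ← Measure.prod_restrict] at h
    exact h.integral_prod_left
  have hedge_flux : ∀ i, Integrable (fun t => ∫ s in Icc (0 : ℝ) 1,
      ⟪gradient (φ t) (x 0 + s • (x i - x 0)), x i - x 0⟫ * V i t s)
      (volume.restrict (Icc (0 : ℝ) 1)) := fun i => by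
    have hi := hV_int i
    rw [Measure.prod_restrict] at hi
    have h := IntegrableOn.continuousOn_mul
      (((continuous_gradient_slice hφ).comp (hγ i).continuous).inner
        (continuous_const (y := x i - x 0))).continuousOn hi hQ
    rw [IntegrableOn, ← Measure.prod_restrict] at h
    exact h.integral_prod_left
  rw [integral_add hbulk_mass (integrable_finsetSum _ fun i _ => hedge_mass i),
    integral_add hbulk_flux (integrable_finsetSum _ fun i _ => hedge_flux i),
    integral_finsetSum _ fun i _ => hedge_mass i, integral_finsetSum _ fun i _ => hedge_flux i]
  have hB := hBulk φ hφ
  have hG := hGraph (fun i t s => φ t (x 0 + s • (x i - x 0))) hψ (by simp)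
  have hslice : ∀ t, Differentiable ℝ (φ t) := fun t y =>
    (hasFDerivAt_slice hdiff t y).differentiableAt
  simp only [deriv_comp_segment (hslice _), one_smul, add_sub_cancel, Finset.sum_add_distrib,
    Finset.sum_sub_distrib] at hG
  linarith
end
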